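/- For every n ≥ 1, the maximal number of alternating monomials in commutator monomials of order n is at least the average: n! · r_n ≥ 2^{n−1} · Ẽ_n. -/

import Mathlib

open scoped Classical

/-- Full plane binary trees with leaves labeled by natural numbers
(representing the variables `X_i`). -/
inductive BTree : Type where
  | leaf : ℕ → BTree
  | node : BTree → BTree → BTree

namespace BTree

/-- The list of leaf labels, from left to right. -/
def leaves : BTree → List ℕ
  | leaf a => [a]
  | node l r => l.leaves ++ r.leaves

/-- The expansion set `W(T, ℓ)` of the commutator monomial modeled by `T`. -/
def words : BTree → Finset (List ℕ)
  | leaf a => {[a]}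
  | node l r =>
      ((l.words ×ˢ r.words).image fun p => p.1 ++ p.2) ∪
      ((l.words ×ˢ r.words).image fun p => p.2 ++ p.1)

end BTree

/-- A word (list of labels) is alternating: consecutive entries differ, and no entry
lies strictly between its two neighbours. -/
def IsAlternating (w : List ℕ) : Prop :=
  (∀ i, i + 1 < w.length → w.getD i 0 ≠ w.getD (i + 1) 0) ∧
  (∀ i, i + 2 < w.length →
    ¬ (w.getD i 0 < w.getD (i + 1) 0 ∧ w.getD (i + 1) 0 < w.getD (i + 2) 0) ∧
    ¬ (w.getD (i + 2) 0 < w.getD (i + 1) 0 ∧ w.getD (i + 1) 0 < w.getD i 0))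

/-- A word is forward alternating: alternating, and it does not start with an ascent. -/
def IsForwardAlternating (w : List ℕ) : Prop :=
  IsAlternating w ∧ (w.length ≤ 1 ∨ w.getD 1 0 < w.getD 0 0)

/-- Number of alternating words in the expansion of `t`. -/
noncomputable def altCount (t : BTree) : ℕ :=
  (t.words.filter fun w => IsAlternating w).card

/-- Number of forward alternating words in the expansion of `t`. -/
noncomputable def faltCount (t : BTree) : ℕ :=
  (t.words.filter fun w => IsForwardAlternating w).card

/-- `rAlt n` : the maximal number of alternating associative monomials in a commutator
monomial whose leaves are labeled bijectively by `{1, …, n}`. -/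
noncomputable def rAlt (n : ℕ) : ℕ :=
  sSup {m | ∃ t : BTree, t.leaves.Perm (List.range' 1 n) ∧ m = altCount t}

/-- `rFAlt n` : the forward-alternating analogue of `rAlt n`. -/
noncomputable def rFAlt (n : ℕ) : ℕ :=
  sSup {m | ∃ t : BTree, t.leaves.Perm (List.range' 1 n) ∧ m = faltCount t}

/-- The number of alternating permutations of `{1, …, n}` (denoted `Ẽ_n`). -/
noncomputable def altPerms (n : ℕ) : ℕ :=
  Nat.card {σ : Equiv.Perm (Fin n) // IsAlternating (List.ofFn fun i => (σ i : ℕ))}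

/-- The number of forward alternating permutations of `{1, …, n}` (denoted `E_n`). -/
noncomputable def faltPerms (n : ℕ) : ℕ :=
  Nat.card {σ : Equiv.Perm (Fin n) // IsForwardAlternating (List.ofFn fun i => (σ i : ℕ))}

namespace BTree

/-- Relabel the leaves of a tree. -/
def map (f : ℕ → ℕ) : BTree → BTree
  | leaf a => leaf (f a)
  | node l r => node (l.map f) (r.map f)

theorem leaves_map (f : ℕ → ℕ) (t : BTree) : (t.map f).leaves = t.leaves.map f := by
  induction t with
  | leaf a => rfl
  | node l r hl hr => simp [map, leaves, hl, hr]

theorem words_map (f : ℕ → ℕ) (t : BTree) :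
    (t.map f).words = t.words.image (List.map f) := by
  induction t with
  | leaf a => simp [map, words]
  | node l r hl hr =>
    ext w
    simp only [map, words, hl, hr, Finset.mem_union, Finset.mem_image, Finset.mem_product,
      Prod.exists]
    constructor
    · rintro (⟨_, _, ⟨⟨u, hu, rfl⟩, v, hv, rfl⟩, rfl⟩ | ⟨_, _, ⟨⟨u, hu, rfl⟩, v, hv, rfl⟩, rfl⟩)
      · exact ⟨u ++ v, Or.inl ⟨u, v, ⟨hu, hv⟩, rfl⟩, List.map_append⟩
      · exact ⟨v ++ u, Or.inr ⟨u, v, ⟨hu, hv⟩, rfl⟩, List.map_append⟩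
    · rintro ⟨_, ⟨u, v, ⟨hu, hv⟩, rfl⟩ | ⟨u, v, ⟨hu, hv⟩, rfl⟩, rfl⟩
      · exact Or.inl ⟨_, _, ⟨⟨u, hu, rfl⟩, v, hv, rfl⟩, List.map_append.symm⟩
      · exact Or.inr ⟨_, _, ⟨⟨u, hu, rfl⟩, v, hv, rfl⟩, List.map_append.symm⟩

theorem perm_leaves_of_mem_words {t : BTree} {w : List ℕ} (hw : w ∈ t.words) :
    w.Perm t.leaves := by
  induction t generalizing w with
  | leaf a =>
    rw [words, Finset.mem_singleton] at hw
    rw [hw, leaves]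
  | node l r hl hr =>
    simp only [words, Finset.mem_union, Finset.mem_image, Finset.mem_product, Prod.exists] at hw
    obtain ⟨u, v, ⟨hu, hv⟩, rfl⟩ | ⟨u, v, ⟨hu, hv⟩, rfl⟩ := hw
    · exact (hl hu).append (hr hv)
    · exact List.perm_append_comm.trans ((hl hu).append (hr hv))

/-- The left comb with `k + 1` leaves, labeled `0, …, k` from left to right. -/
def comb : ℕ → BTree
  | 0 => leaf 0
  | k + 1 => node (comb k) (leaf (k + 1))

theorem leaves_comb (k : ℕ) : (comb k).leaves = List.range (k + 1) := by
  induction k with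
  | zero => rfl
  | succ k ih => rw [comb, leaves, ih, leaves, List.range_succ (n := k + 1)]

theorem card_words_comb (k : ℕ) : (comb k).words.card = 2 ^ k := by
  induction k with
  | zero => rfl
  | succ k ih =>
    have hwords : (comb (k + 1)).words =
        (comb k).words.image (· ++ [k + 1]) ∪ (comb k).words.image ((k + 1) :: ·) := by
      ext w
      simp [comb, words]
    rw [hwords, Finset.card_union_of_disjoint, Finset.card_image_of_injective,
      Finset.card_image_of_injective, ih, pow_succ, mul_two]
    · exact List.cons_injective
    · exact List.append_left_injective _
    · rw [Finset.disjoint_left]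
      intro w h₁ h₂
      obtain ⟨u, hu, rfl⟩ := Finset.mem_image.1 h₁
      obtain ⟨v, -, h⟩ := Finset.mem_image.1 h₂
      have hperm := perm_leaves_of_mem_words hu
      rw [leaves_comb] at hperm
      cases u with
      | nil => simpa using hperm.length_eq
      | cons a u =>
        have ha := hperm.mem_iff.1 List.mem_cons_self
        rw [List.cons_append, List.cons.injEq] at h
        rw [← h.1, List.mem_range] at ha
        exact ha.false

end BTree

theorem isAlternating_map_succ (w : List ℕ) :
    IsAlternating (w.map Nat.succ) ↔ IsAlternating w := by
  have key : ∀ i, i < w.length → (w.map Nat.succ).getD i 0 = w.getD i 0 + 1 := by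
    intro i hi
    simp [hi]
  unfold IsAlternating
  rw [List.length_map]
  refine and_congr (forall₂_congr fun i hi => ?_) (forall₂_congr fun i hi => ?_)
  · rw [key i (by omega), key (i + 1) hi]
    omega
  · rw [key i (by omega), key (i + 1) (by omega), key (i + 2) hi]
    omega

theorem altCount_map {f : ℕ → ℕ} (hf : f.Injective) (t : BTree) :
    altCount (t.map f) = (t.words.filter fun w => IsAlternating (w.map f)).card := by
  rw [altCount, BTree.words_map, Finset.filter_image,
    Finset.card_image_of_injective _ (List.map_injective_iff.2 hf)]

theorem altCount_le_rAlt {n : ℕ} {t : BTree} (ht : t.leaves.Perm (List.range' 1 n)) :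
    altCount t ≤ rAlt n := by
  refine le_csSup ⟨(List.range' 1 n).permutations.toFinset.card, ?_⟩ ⟨t, ht, rfl⟩
  rintro _ ⟨s, hs, rfl⟩
  refine Finset.card_le_card fun w hw => ?_
  rw [List.mem_toFinset, List.mem_permutations]
  exact (BTree.perm_leaves_of_mem_words (Finset.mem_filter.1 hw).1).trans hs

theorem List.Perm.exists_ofFn_eq_of_range {n : ℕ} {w : List ℕ} (hw : w.Perm (List.range n)) :
    ∃ τ : Equiv.Perm (Fin n), w = List.ofFn fun i => (τ i : ℕ) := by
  have hlen : w.length = n := by simpa using hw.length_eq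
  have hnodup : w.Nodup := hw.nodup_iff.2 List.nodup_range
  have hlt : ∀ i : Fin n, w[i.1]'(hlen.symm ▸ i.2) < n := fun i =>
    List.mem_range.1 (hw.mem_iff.1 (List.getElem_mem _))
  have hinj : Function.Injective fun i : Fin n => (⟨_, hlt i⟩ : Fin n) := by
    intro i j hij
    exact Fin.ext ((hnodup.getElem_inj_iff).1 (Fin.mk.inj hij))
  refine ⟨Equiv.ofBijective _ (Finite.injective_iff_bijective.1 hinj), ?_⟩
  exact List.ext_getElem (by simp [hlen]) fun i _ _ => by simp

/-- The injective renaming of leaves sending `i < n` to `σ i + 1`. -/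
noncomputable def succPerm {n : ℕ} (σ : Equiv.Perm (Fin n)) (k : ℕ) : ℕ :=
  (σ.viaEmbedding Fin.valEmbedding k).succ

theorem succPerm_injective {n : ℕ} (σ : Equiv.Perm (Fin n)) : (succPerm σ).Injective :=
  Nat.succ_injective.comp (Equiv.injective _)

theorem succPerm_val {n : ℕ} (σ : Equiv.Perm (Fin n)) (i : Fin n) :
    succPerm σ i = (σ i : ℕ) + 1 :=
  congrArg Nat.succ (σ.viaEmbedding_apply Fin.valEmbedding i)

theorem map_succPerm_range_perm {n : ℕ} (σ : Equiv.Perm (Fin n)) :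
    ((List.range n).map (succPerm σ)).Perm (List.range' 1 n) := by
  rw [List.perm_ext_iff_of_nodup (List.nodup_range.map (succPerm_injective σ)) List.nodup_range']
  intro a
  rw [List.mem_map, List.mem_range'_1]
  constructor
  · rintro ⟨k, hk, rfl⟩
    have := succPerm_val σ ⟨k, List.mem_range.1 hk⟩
    have := (σ ⟨k, List.mem_range.1 hk⟩).2
    simp only at *
    omega
  · rintro ⟨h₁, h₂⟩
    refine ⟨σ.symm ⟨a - 1, by omega⟩, List.mem_range.2 (Fin.is_lt _), ?_⟩
    rw [succPerm_val, Equiv.apply_symm_apply]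
    exact Nat.sub_add_cancel h₁

theorem card_isAlternating_map_succPerm {n : ℕ} {w : List ℕ} (hw : w.Perm (List.range n)) :
    (Finset.univ.filter fun σ : Equiv.Perm (Fin n) =>
      IsAlternating (w.map (succPerm σ))).card = altPerms n := by
  obtain ⟨τ, rfl⟩ := hw.exists_ofFn_eq_of_range
  rw [altPerms, ← Fintype.card_subtype, ← Nat.card_eq_fintype_card]
  refine Nat.card_congr ((Equiv.mulRight τ).subtypeEquiv fun σ => ?_)
  rw [← isAlternating_map_succ (List.ofFn _), List.map_ofFn, List.map_ofFn]
  simp only [Function.comp_def, succPerm_val, Equiv.coe_mulRight, Equiv.Perm.mul_apply,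
    Nat.succ_eq_add_one]

/-- The maximum is at least the average: `n! ⬝ r_n ≥ 2^{n-1} Ẽ_n`. -/
theorem rAlt_ge_average (n : ℕ) (hn : 1 ≤ n) :
    2 ^ (n - 1) * altPerms n ≤ Nat.factorial n * rAlt n := by
  have hleaves : (BTree.comb (n - 1)).leaves = List.range n := by
    rw [BTree.leaves_comb, Nat.sub_add_cancel hn]
  calc 2 ^ (n - 1) * altPerms n
      = ∑ w ∈ (BTree.comb (n - 1)).words, (Finset.univ.filter fun σ : Equiv.Perm (Fin n) =>
          IsAlternating (w.map (succPerm σ))).card := by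
        rw [Finset.sum_congr rfl fun w hw => card_isAlternating_map_succPerm
          (hleaves ▸ BTree.perm_leaves_of_mem_words hw), Finset.sum_const,
          BTree.card_words_comb, smul_eq_mul]
    _ = ∑ σ : Equiv.Perm (Fin n), altCount ((BTree.comb (n - 1)).map (succPerm σ)) := by
        simp only [altCount_map (succPerm_injective _)]
        exact Finset.sum_card_bipartiteAbove_eq_sum_card_bipartiteBelow _
    _ ≤ ∑ _σ : Equiv.Perm (Fin n), rAlt n := Finset.sum_le_sum fun σ _ => altCount_le_rAlt (by
        rw [BTree.leaves_map, hleaves]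
        exact map_succPerm_range_perm σ)
    _ = Nat.factorial n * rAlt n := by
        rw [Finset.sum_const, Finset.card_univ, Fintype.card_perm, Fintype.card_fin, smul_eq_mul]
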